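/- Suppose f is a transduction that is invariant under permutations and without data peeking, E is an equalizing scheme for f with associated sequence δ1 δ2 ⋯, u, u', v are data words, σ ∈ Σ, ifl_f(u) = d_m ⋯ d_1, d_0 is a data value not in {d_1,…,d_m}, δ_0 is a data value not in {δ_1,…,δ_m}, (d,η) ∈ {(d_i,δ_i) : 0 ≤ i ≤ m}, π tracks influencing values on E(u)(u)·(σ,η), and u ≡_f u'. Then f(u | (σ,d)·E(u·(σ,d))^{-1}(v)̲) = f(u | E(u)^{-1}((σ,η)·π(v))̲). Moreover, if (d,η) ∈ {(d_i,δ_i) : 1 ≤ i ≤ m}, then f(u̲ | (σ,d) | E(u·(σ,d))^{-1}(v)̲) = E(u)^{-1}(f_z(E(u')(u')̲ | (σ,η) | π(v)̲)) where z = |u| − |u'|; and if (d,η) = (d_0,δ_0), then f(u̲ | (σ,d) | E(u·(σ,d))^{-1}(v)̲) = (E(u)^{-1} ∘ π')(f_z(E(u')(u')̲ | (σ,η) | π(v)̲)), where π' is the permutation interchanging δ_0 and E(u)(d_0) and fixing all other data values. -/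

import Mathlib

namespace SSRT

/-- Elements of a factored output: either a retained output triple
(letter, data value, origin — integer origins allow shifting by `z`),
or one of the placeholder marks `(*,*,left)`, `(*,*,middle)`, `(*,*,right)`. -/
inductive FOElem (G D : Type) where
  | tri (g : G) (d : D) (o : ℤ)
  | left
  | middle
  | right
  deriving DecidableEq

namespace FOElem

def isTri {G D : Type} : FOElem G D → Bool
  | .tri _ _ _ => true
  | _ => false

def isMark {G D : Type} (e : FOElem G D) : Bool := !e.isTri

end FOElem

/-- Data words over the input alphabet `A` with data from `D`. -/
abbrev DataWord (A D : Type) := List (A × D)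

/-- Data words with origin information over the output alphabet `G`;
positions of the input are numbered 1,…,n. -/
abbrev OutWord (G D : Type) := List (G × D × ℕ)

/-- A transduction. -/
abbrev Transduction (A G D : Type) := DataWord A D → OutWord G D

variable {A G D : Type}

/-- Apply a permutation of data values to a data word. -/
def permW (π : Equiv.Perm D) (u : DataWord A D) : DataWord A D :=
  u.map fun p => (p.1, π p.2)

/-- Apply a permutation of data values to an output word. -/
def permOut (π : Equiv.Perm D) (w : OutWord G D) : OutWord G D :=
  w.map fun t => (t.1, π t.2.1, t.2.2)

/-- Apply a permutation of data values to a factored output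
(placeholder marks are unchanged). -/
def permFO (π : Equiv.Perm D) : List (FOElem G D) → List (FOElem G D) :=
  List.map fun e => match e with
    | .tri g d o => .tri g (π d) o
    | .left => .left
    | .middle => .middle
    | .right => .right

/-- Shift the origin of every retained triple by `z`. -/
def foShift (z : ℤ) : List (FOElem G D) → List (FOElem G D) :=
  List.map fun e => match e with
    | .tri g d o => .tri g d (o + z)
    | .left => .left
    | .middle => .middle
    | .right => .right

/-- `f` is invariant under permutations. -/
def PermInvariant (f : Transduction A G D) : Prop :=
  ∀ (π : Equiv.Perm D) (u : DataWord A D), f (permW π u) = permOut π (f u)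

/-- `f` is without data peeking: every data value output from origin `o`
already occurs in the input at some position `≤ o`. -/
def NoDataPeeking (f : Transduction A G D) : Prop :=
  ∀ (w : DataWord A D) (t : G × D × ℕ), t ∈ f w →
    ∃ (i : ℕ) (a : A), w[i]? = some (a, t.2.1) ∧ i + 1 ≤ t.2.2

/-- `f` has linear blow up. -/
def LinearBlowUp (f : Transduction A G D) : Prop :=
  ∃ K : ℕ, ∀ (w : DataWord A D) (o : ℕ), 1 ≤ o → o ≤ w.length →
    ((f w).filter fun t => t.2.2 == o).length ≤ K

variable [DecidableEq G] [DecidableEq D]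

/-- Merge consecutive occurrences of equal placeholder marks into one. -/
def collapse : List (FOElem G D) → List (FOElem G D)
  | [] => []
  | [a] => [a]
  | a :: b :: rest =>
      if a = b ∧ a.isMark then collapse (b :: rest)
      else a :: collapse (b :: rest)

/-- The factored output `f(u̲ ∣ v)`. -/
def leftFac (f : Transduction A G D) (u v : DataWord A D) : List (FOElem G D) :=
  collapse ((f (u ++ v)).map fun t =>
    if t.2.2 ≤ u.length then FOElem.left else FOElem.tri t.1 t.2.1 (t.2.2 : ℤ))

/-- The factored output `f(u ∣ v̲)`. -/
def rightFac (f : Transduction A G D) (u v : DataWord A D) : List (FOElem G D) :=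
  collapse ((f (u ++ v)).map fun t =>
    if u.length < t.2.2 then FOElem.right else FOElem.tri t.1 t.2.1 (t.2.2 : ℤ))

/-- The factored output `f(u̲ ∣ v ∣ w̲)`. -/
def threeFac (f : Transduction A G D) (u v w : DataWord A D) : List (FOElem G D) :=
  collapse ((f (u ++ v ++ w)).map fun t =>
    if t.2.2 ≤ u.length then FOElem.left
    else if t.2.2 ≤ u.length + v.length then FOElem.tri t.1 t.2.1 (t.2.2 : ℤ)
    else FOElem.right)

/-- The factored output `f(u̲ ∣ v̲ ∣ w̲)`. -/
def allFac (f : Transduction A G D) (u v w : DataWord A D) : List (FOElem G D) :=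
  collapse ((f (u ++ v ++ w)).map fun t =>
    if t.2.2 ≤ u.length then FOElem.left
    else if t.2.2 ≤ u.length + v.length then FOElem.middle
    else FOElem.right)

/-- `u[d/d']`: replace every occurrence of the data value `d` by `d'`. -/
def replaceD (u : DataWord A D) (d d' : D) : DataWord A D :=
  u.map fun p => (p.1, if p.2 = d then d' else p.2)

/-- Isomorphism of data words: same length, same letters, and the same
equalities among the data values at the various positions. -/
def Iso (u u' : DataWord A D) : Prop :=
  u.length = u'.length ∧
  (∀ i : ℕ, u[i]?.map Prod.fst = u'[i]?.map Prod.fst) ∧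
  (∀ i j : ℕ, (u[i]?.map Prod.snd = u[j]?.map Prod.snd) ↔
          (u'[i]?.map Prod.snd = u'[j]?.map Prod.snd))

/-- `d'` is a safe replacement for `d` in `u`. -/
def SafeRepl (d d' : D) (u : DataWord A D) : Prop := Iso (replaceD u d d') u

def OccursIn (d : D) (u : DataWord A D) : Prop := ∃ p ∈ u, p.2 = d

/-- `d` is `f`-memorable in `u`. -/
def Memorable (f : Transduction A G D) (d : D) (u : DataWord A D) : Prop :=
  ∃ (v : DataWord A D) (d' : D), SafeRepl d d' u ∧
    leftFac f (replaceD u d d') v ≠ leftFac f u v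

/-- `d` is `f`-vulnerable in `u`. -/
def Vulnerable (f : Transduction A G D) (d : D) (u : DataWord A D) : Prop :=
  ∃ (u' v : DataWord A D) (d' : D), ¬ OccursIn d u' ∧
    SafeRepl d d' (u ++ u' ++ v) ∧
    rightFac f (u ++ u') (replaceD v d d') ≠ rightFac f (u ++ u') v

/-- `d` is `f`-influencing in `u`. -/
def Influencing (f : Transduction A G D) (d : D) (u : DataWord A D) : Prop :=
  Memorable f d u ∨ Vulnerable f d u

/-- The last occurrence of `d` in `u` is at (0-based) index `i`. -/
def IsLastOcc (u : DataWord A D) (d : D) (i : ℕ) : Prop :=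
  (∃ a : A, u[i]? = some (a, d)) ∧ ∀ j : ℕ, i < j → ∀ p : A × D, u[j]? = some p → p.2 ≠ d

/-- `d` is fresher than `e` in `u`: the last occurrence of `d` in `u` is
strictly to the right of the last occurrence of `e`. -/
def Fresher (u : DataWord A D) (d e : D) : Prop :=
  ∃ i j : ℕ, IsLastOcc u d i ∧ IsLastOcc u e j ∧ j < i

/-- `l` is the sequence of all `f`-influencing values of `u`, listed freshest
first: the `i`-th element (1-based) is the `i`-th `f`-influencing value of `u`.
(The paper writes this sequence in the reverse direction, as `d_m ⋯ d_1`.) -/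
def IsIflSeq (f : Transduction A G D) (u : DataWord A D) (l : List D) : Prop :=
  (∀ d, d ∈ l ↔ Influencing f d u) ∧ l.Nodup ∧
  ∀ (i j : ℕ) (hi : i < l.length) (hj : j < l.length), i < j →
    Fresher u (l.get ⟨i, hi⟩) (l.get ⟨j, hj⟩)

/-- The type annotation of an influencing value. -/
inductive IflType where
  | vm | m | v
  deriving DecidableEq

def HasIflType (f : Transduction A G D) (u : DataWord A D) (d : D) :
    IflType → Prop
  | .vm => Memorable f d u ∧ Vulnerable f d u
  | .m => Memorable f d u ∧ ¬ Vulnerable f d u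
  | .v => Vulnerable f d u ∧ ¬ Memorable f d u

/-- `al` is `aifl_f(u)` (listed freshest first). -/
def IsAiflSeq (f : Transduction A G D) (u : DataWord A D)
    (al : List (D × IflType)) : Prop :=
  IsIflSeq f u (al.map Prod.fst) ∧ ∀ p ∈ al, HasIflType f u p.1 p.2

/-- The equivalence `u1 ≡_f u2`. -/
def FEquiv (f : Transduction A G D) (u1 u2 : DataWord A D) : Prop :=
  ∃ π : Equiv.Perm D,
    (∀ v, foShift ((u1.length : ℤ) - (u2.length : ℤ))
        (leftFac f (permW π u2) v) = leftFac f u1 v) ∧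
    (∀ al, IsAiflSeq f (permW π u2) al ↔ IsAiflSeq f u1 al) ∧
    (∀ u v1 v2, (rightFac f (u1 ++ u) v1 = rightFac f (u1 ++ u) v2) ↔
        (rightFac f (permW π u2 ++ u) v1 = rightFac f (permW π u2 ++ u) v2))

/-- `≡_f` has finitely many equivalence classes. -/
def FEquivFiniteIndex (f : Transduction A G D) : Prop :=
  ∃ S : Set (DataWord A D), S.Finite ∧ ∀ u, ∃ r ∈ S, FEquiv f r u

/-- `E` is an equalizing scheme for `f` with associated sequence `δ 1, δ 2, ⋯`
(the value `δ 0` is irrelevant here): for every data word `u`, the `i`-th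
`f`-influencing value of `E(u)(u)` is `δ i`. -/
def IsEqualizingSchemeWith (f : Transduction A G D)
    (E : DataWord A D → Equiv.Perm D) (δ : ℕ → D) : Prop :=
  ∀ (u : DataWord A D) (l : List D), IsIflSeq f (permW (E u) u) l →
    ∀ (i : ℕ) (h : i < l.length), l.get ⟨i, h⟩ = δ (i + 1)

def IsEqualizingScheme (f : Transduction A G D)
    (E : DataWord A D → Equiv.Perm D) : Prop :=
  ∃ δ : ℕ → D, IsEqualizingSchemeWith f E δ

/-- `v1 ≡_f^E v2`. -/
def REquiv (f : Transduction A G D) (E : DataWord A D → Equiv.Perm D)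
    (v1 v2 : DataWord A D) : Prop :=
  ∀ u, rightFac f (permW (E u) u) v1 = rightFac f (permW (E u) u) v2

/-- `≡_f^E` has finitely many equivalence classes. -/
def REquivFiniteIndex (f : Transduction A G D)
    (E : DataWord A D → Equiv.Perm D) : Prop :=
  ∃ S : Set (DataWord A D), S.Finite ∧ ∀ v, ∃ r ∈ S, REquiv f E r v

/-- The blocks of a factored output: the maximal infixes consisting of
retained triples, in order. -/
def triBlocks (l : List (FOElem G D)) : List (List (FOElem G D)) :=
  (l.splitOnP fun e => !e.isTri).filter fun b => !b.isEmpty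

/-- Helper for concretizing non-right blocks: walk `f(u̲ ∣ v̲ ∣ w̲)` and
substitute the `i`-th occurrence of the left mark by the `i`-th left block
(taken from `L`) and the `j`-th occurrence of the middle mark by the `j`-th
middle block (taken from `M`); right marks are turned into separators. -/
def annotateNR (L M : List (List (FOElem G D))) :
    List (FOElem G D) → ℕ → ℕ → List (Option (List (FOElem G D)))
  | [], _, _ => []
  | .left :: rest, i, j => some (L.getD i []) :: annotateNR L M rest (i + 1) j
  | .middle :: rest, i, j => some (M.getD j []) :: annotateNR L M rest i (j + 1)
  | .right :: rest, i, j => none :: annotateNR L M rest i j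
  | .tri g d o :: rest, i, j => some [.tri g d o] :: annotateNR L M rest i j

/-- The concretizations of the non-right blocks of `f(u̲ ∣ v̲ ∣ w̲)`, in order:
the concretization of a non-right block is the concatenation of the
concretizations of the left blocks (taken from `f(u ∣ v·w̲)`) and the middle
blocks (taken from `f(u̲ ∣ v ∣ w̲)`) occurring in it. -/
def concretizedNRBlocks (f : Transduction A G D) (u v w : DataWord A D) :
    List (List (FOElem G D)) :=
  (((annotateNR (triBlocks (rightFac f u (v ++ w))) (triBlocks (threeFac f u v w))
        (allFac f u v w) 0 0).splitOnP fun o => o.isNone).filter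
      fun grp => !grp.isEmpty).map fun grp => grp.reduceOption.flatten

/-- `π` tracks influencing values (relative to the sequence `δ`) on `w`:
the `i`-th `f`-influencing value of `w` is `π (δ i)`. -/
def TracksInfluencing (f : Transduction A G D) (δ : ℕ → D) (π : Equiv.Perm D)
    (w : DataWord A D) : Prop :=
  ∀ l, IsIflSeq f w l → ∀ (i : ℕ) (h : i < l.length), l.get ⟨i, h⟩ = π (δ (i + 1))

end SSRT

set_option linter.unusedSectionVars false
set_option linter.unusedVariables false

namespace SSRT

section aux
variable {A G D : Type}

/-! ### Basic facts on permutations of data words -/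

theorem permW_append (π : Equiv.Perm D) (u v : DataWord A D) :
    permW π (u ++ v) = permW π u ++ permW π v := by simp [permW]

theorem permW_cons (π : Equiv.Perm D) (p : A × D) (v : DataWord A D) :
    permW π (p :: v) = (p.1, π p.2) :: permW π v := by simp [permW]

theorem permW_mul (π ρ : Equiv.Perm D) (u : DataWord A D) :
    permW (π * ρ) u = permW π (permW ρ u) := by simp [permW]

theorem permW_one (u : DataWord A D) : permW 1 u = u := by simp [permW]

theorem permW_length (π : Equiv.Perm D) (u : DataWord A D) :
    (permW π u).length = u.length := by simp [permW]

theorem permFO_mul (π ρ : Equiv.Perm D) (u : List (FOElem G D)) :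
    permFO (π * ρ) u = permFO π (permFO ρ u) := by
  simp only [permFO, List.map_map]
  apply List.map_congr_left
  intro e _
  cases e <;> rfl

theorem permFO_one (u : List (FOElem G D)) : permFO 1 u = u := by
  induction u with
  | nil => rfl
  | cons e u ih =>
    simp only [permFO, List.map_cons] at *
    rw [ih]
    cases e <;> rfl

theorem permFO_inj (π : Equiv.Perm D) {u v : List (FOElem G D)} :
    permFO π u = permFO π v ↔ u = v := by
  constructor
  · intro h
    have := congrArg (permFO π⁻¹) h
    rwa [← permFO_mul, ← permFO_mul, inv_mul_cancel, permFO_one, permFO_one] at this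
  · rintro rfl; rfl

theorem foShift_permFO (z : ℤ) (π : Equiv.Perm D) (u : List (FOElem G D)) :
    foShift z (permFO π u) = permFO π (foShift z u) := by
  simp only [permFO, foShift, List.map_map]
  apply List.map_congr_left
  intro e _
  cases e <;> rfl

theorem occ_iff (d : D) (u : DataWord A D) : OccursIn d u ↔ d ∈ u.map Prod.snd := by
  simp [OccursIn]

theorem occ_append (d : D) (u v : DataWord A D) :
    OccursIn d (u ++ v) ↔ OccursIn d u ∨ OccursIn d v := by
  simp only [occ_iff, List.map_append, List.mem_append]

theorem occ_perm (τ : Equiv.Perm D) (d : D) (u : DataWord A D) :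
    OccursIn (τ d) (permW τ u) ↔ OccursIn d u := by
  simp [OccursIn, permW]

theorem permW_eq_self (τ : Equiv.Perm D) (u : DataWord A D)
    (h : ∀ d, OccursIn d u → τ d = d) : permW τ u = u := by
  unfold permW
  conv_rhs => rw [← List.map_id u]
  apply List.map_congr_left
  intro p hp
  simp [h p.2 ⟨p, hp, rfl⟩]

theorem exists_fresh [Infinite D] (l : List D) : ∃ c : D, c ∉ l := by
  classical
  obtain ⟨c, hc⟩ := Infinite.exists_notMem_finset l.toFinset
  exact ⟨c, by simpa using hc⟩

variable [DecidableEq D]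

theorem permW_swap_self (x y : D) (u : DataWord A D) (hx : ¬ OccursIn x u)
    (hy : ¬ OccursIn y u) : permW (Equiv.swap x y) u = u := by
  apply permW_eq_self
  intro d hd
  apply Equiv.swap_apply_of_ne_of_ne
  · rintro rfl; exact hx hd
  · rintro rfl; exact hy hd

theorem permW_swap_swap (x y : D) (u : DataWord A D) :
    permW (Equiv.swap x y) (permW (Equiv.swap x y) u) = u := by
  rw [← permW_mul, Equiv.swap_mul_self, permW_one]

theorem replaceD_eq_swap (d d' : D) (u : DataWord A D) (h : ¬ OccursIn d' u) :
    replaceD u d d' = permW (Equiv.swap d d') u := by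
  unfold permW replaceD
  apply List.map_congr_left
  intro p hp
  by_cases h1 : p.2 = d
  · simp [h1]
  · have h2 : p.2 ≠ d' := by
      intro h2; exact h ⟨p, hp, h2⟩
    simp [h1, Equiv.swap_apply_of_ne_of_ne h1 h2]

theorem replaceD_self (d d' : D) (u : DataWord A D) (h : ¬ OccursIn d u) :
    replaceD u d d' = u := by
  unfold replaceD
  conv_rhs => rw [← List.map_id u]
  apply List.map_congr_left
  intro p hp
  have : p.2 ≠ d := fun h2 => h ⟨p, hp, h2⟩
  simp [this]

theorem replaceD_same (d : D) (u : DataWord A D) : replaceD u d d = u := by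
  unfold replaceD
  conv_rhs => rw [← List.map_id u]
  apply List.map_congr_left
  intro p hp
  by_cases h : p.2 = d
  · subst h; simp
  · simp [h]

theorem occ_getElem (d : D) (u : DataWord A D) :
    OccursIn d u ↔ ∃ i : ℕ, u[i]?.map Prod.snd = some d := by
  constructor
  · rintro ⟨p, hp, rfl⟩
    obtain ⟨i, hi⟩ := List.mem_iff_getElem?.1 hp
    exact ⟨i, by simp [hi]⟩
  · rintro ⟨i, hi⟩
    rw [Option.map_eq_some_iff] at hi
    obtain ⟨p, hp, rfl⟩ := hi
    exact ⟨p, List.mem_of_getElem? hp, rfl⟩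

theorem safe_of_fresh (d d' : D) (u : DataWord A D) (h : ¬ OccursIn d' u) :
    SafeRepl d d' u := by
  unfold SafeRepl
  rw [replaceD_eq_swap d d' u h]
  refine ⟨permW_length _ _, ?_, ?_⟩
  · intro i
    simp [permW, Function.comp_def]
  · intro i j
    have : ∀ i : ℕ, (permW (Equiv.swap d d') u)[i]?.map Prod.snd
        = (u[i]?.map Prod.snd).map (Equiv.swap d d') := by
      intro i; simp [permW, Function.comp_def]
    rw [this, this]
    exact (Option.map_injective (Equiv.injective _)).eq_iff

theorem safe_cases (d d' : D) (u : DataWord A D) (h : SafeRepl d d' u) :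
    d = d' ∨ ¬ OccursIn d u ∨ ¬ OccursIn d' u := by
  by_contra hc
  push Not at hc
  obtain ⟨hne, h1, h2⟩ := hc
  rw [occ_getElem] at h1 h2
  obtain ⟨i, hi⟩ := h1
  obtain ⟨j, hj⟩ := h2
  have h3 := (h.2.2 i j).1 (by
    rw [Option.map_eq_some_iff] at hi hj
    obtain ⟨p, hp, hp'⟩ := hi
    obtain ⟨q, hq, hq'⟩ := hj
    simp only [replaceD, List.getElem?_map, hp, hq, Option.map_some, hp', hq', if_true]
    split_ifs <;> rfl)
  rw [hi, hj] at h3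
  exact hne (by simpa using h3)

/-- A property of data words preserved by elementary transpositions (avoiding `M`)
with a fresh value is preserved by any permutation that is the identity on `M`. -/
theorem perm_generic [Infinite D] (M : Set D) (hMfin : M.Finite) (P : DataWord A D → Prop)
    (hstep : ∀ u x y, P u → x ∉ M → y ∉ M → ¬ OccursIn y u → P (permW (Equiv.swap x y) u))
    (τ : Equiv.Perm D) (hτ : ∀ x ∈ M, τ x = x) (u : DataWord A D) (hu : P u) :
    P (permW τ u) := by
  -- arbitrary transpositions
  have hstep2 : ∀ u x y, P u → x ∉ M → y ∉ M → P (permW (Equiv.swap x y) u) := by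
    intro u x y hu hx hy
    by_cases hyu : OccursIn y u
    swap
    · exact hstep u x y hu hx hy hyu
    by_cases hxy : x = y
    · subst hxy; simpa [permW_one, ← Equiv.Perm.one_def] using hu
    by_cases hxu : OccursIn x u
    swap
    · rw [Equiv.swap_comm]; exact hstep u y x hu hy hx hxu
    have hMf : ∃ c, c ∉ M ∧ c ∉ u.map Prod.snd := by
      obtain ⟨c, hc⟩ := Infinite.exists_notMem_finset (hMfin.toFinset ∪ (u.map Prod.snd).toFinset)
      rw [Finset.mem_union, not_or] at hc
      exact ⟨c, by simpa using hc.1, by simpa using hc.2⟩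
    · obtain ⟨c, hcM, hcu⟩ := hMf
      rw [← occ_iff] at hcu
      have hcx : c ≠ x := by rintro rfl; exact hcu hxu
      have hcy : c ≠ y := by rintro rfl; exact hcu hyu
      have h1 := hstep u x c hu hx hcM hcu
      have h2 := hstep _ y x h1 hy hx (by
        have := occ_perm (Equiv.swap x c) c u
        rw [Equiv.swap_apply_right] at this
        rwa [this])
      have h3 := hstep _ c y h2 hcM hy (by
        have := occ_perm (Equiv.swap y x) x (permW (Equiv.swap x c) u)
        rw [Equiv.swap_apply_right] at this
        rw [this]
        have := occ_perm (Equiv.swap x c) c u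
        rw [Equiv.swap_apply_right] at this
        rwa [this])
      rw [← permW_mul, ← permW_mul] at h3
      convert h3 using 1
      unfold permW
      apply List.map_congr_left
      intro p hp
      have hpc : p.2 ≠ c := by
        intro h; exact hcu ⟨p, hp, h⟩
      simp only [Prod.mk.injEq, true_and, Equiv.Perm.mul_apply]
      by_cases h1 : p.2 = x
      · rw [h1, Equiv.swap_apply_left, Equiv.swap_apply_left,
          Equiv.swap_apply_of_ne_of_ne hcy hcx, Equiv.swap_apply_left]
      · by_cases h2 : p.2 = y
        · rw [h2, Equiv.swap_apply_right,
            Equiv.swap_apply_of_ne_of_ne (Ne.symm hxy) (Ne.symm hcy), Equiv.swap_apply_left,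
            Equiv.swap_apply_of_ne_of_ne (Ne.symm hcx) hxy]
        · rw [Equiv.swap_apply_of_ne_of_ne h1 h2, Equiv.swap_apply_of_ne_of_ne h1 hpc,
            Equiv.swap_apply_of_ne_of_ne h2 h1, Equiv.swap_apply_of_ne_of_ne hpc h2]
  induction hn : ((u.map Prod.snd).toFinset.filter (fun z => τ z ≠ z)).card
    using Nat.strong_induction_on generalizing u τ with
  | _ n ih =>
    by_cases hex : ∃ x, OccursIn x u ∧ τ x ≠ x
    · obtain ⟨x, hxu, hx⟩ := hex
      have hxM : x ∉ M := fun h => hx (hτ x h)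
      have hyM : τ x ∉ M := fun h => hx (τ.injective (hτ _ h))
      have h1 := hstep2 u x (τ x) hu hxM hyM
      have h2 := ih _ ?_ (τ * Equiv.swap x (τ x)) ?_ _ h1 rfl
      · rwa [permW_mul, permW_swap_swap] at h2
      · rw [← hn]
        refine lt_of_le_of_lt (Finset.card_le_card (t := (((u.map Prod.snd).toFinset.filter
          (fun z => τ z ≠ z)).erase x).image (Equiv.swap x (τ x))) ?_)
          (lt_of_le_of_lt Finset.card_image_le (Finset.card_erase_lt_of_mem ?_))
        · intro z hz
          simp only [Finset.mem_filter, List.mem_toFinset, ← occ_iff] at hz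
          obtain ⟨hz1, hz2⟩ := hz
          simp only [Finset.mem_image, Finset.mem_erase, Finset.mem_filter, List.mem_toFinset,
            ← occ_iff]
          refine ⟨Equiv.swap x (τ x) z, ⟨?_, ?_, ?_⟩, by simp⟩
          · intro h
            rw [Equiv.Perm.mul_apply, h] at hz2
            apply hz2
            rw [← h]
            have := congrArg (Equiv.swap x (τ x)) h
            rw [Equiv.swap_apply_self, Equiv.swap_apply_left] at this
            rw [h, this]
          · rw [← occ_perm (Equiv.swap x (τ x))]
            simpa using hz1
          · intro h
            rw [Equiv.Perm.mul_apply, h] at hz2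
            apply hz2
            have h3 : z ≠ τ x := by
              rintro rfl
              rw [Equiv.swap_apply_right] at h
              exact hx h
            have h4 : z ≠ x := by
              rintro rfl
              rw [Equiv.swap_apply_left] at h
              exact hx (τ.injective h)
            exact Equiv.swap_apply_of_ne_of_ne h4 h3
        · simp only [Finset.mem_filter, List.mem_toFinset, ← occ_iff]
          exact ⟨hxu, hx⟩
      · intro z hz
        rw [Equiv.Perm.mul_apply, Equiv.swap_apply_of_ne_of_ne, hτ z hz]
        · rintro rfl; exact hxM hz
        · rintro rfl; exact hyM hz
    · push Not at hex
      rwa [permW_eq_self τ u hex]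

end aux
end SSRT

namespace SSRT
section aux2
variable {A G D : Type} [DecidableEq G] [DecidableEq D]

/-! ### Facts on `collapse` -/

theorem collapse_cons (x : FOElem G D) (l : List (FOElem G D)) :
    collapse (x :: l) = if l.head? = some x ∧ x.isMark then collapse l else x :: collapse l := by
  cases l with
  | nil => simp [collapse]
  | cons b l =>
    simp only [collapse, List.head?_cons, Option.some.injEq]
    simp only [eq_comm]

theorem head_collapse (l : List (FOElem G D)) : (collapse l).head? = l.head? := by
  induction l with
  | nil => rfl
  | cons x l ih =>
    rw [collapse_cons]
    split_ifs with h
    · rw [ih, h.1]; rfl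
    · rfl

theorem collapse_cons_inj (x : FOElem G D) (l₁ l₂ : List (FOElem G D))
    (hh : (x.isMark = true → (l₁.head? = some x ↔ l₂.head? = some x)))
    (h : collapse (x :: l₁) = collapse (x :: l₂)) : collapse l₁ = collapse l₂ := by
  rw [collapse_cons, collapse_cons] at h
  by_cases hm : x.isMark = true
  · have hh' := hh hm
    by_cases h1 : l₁.head? = some x
    · rw [if_pos ⟨h1, hm⟩, if_pos ⟨hh'.1 h1, hm⟩] at h
      exact h
    · rw [if_neg (fun h' => h1 h'.1), if_neg (fun h' => h1 (hh'.2 h'.1))] at h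
      exact List.tail_eq_of_cons_eq h
  · rw [if_neg (fun h' => hm h'.2), if_neg (fun h' => hm h'.2)] at h
    exact List.tail_eq_of_cons_eq h

theorem collapse_map_inj (g : FOElem G D → FOElem G D) (hg : Function.Injective g)
    (hm : ∀ e, (g e).isMark = e.isMark) (l : List (FOElem G D)) :
    collapse (l.map g) = (collapse l).map g := by
  induction l with
  | nil => rfl
  | cons x l ih =>
    rw [List.map_cons, collapse_cons, collapse_cons, hm, ih]
    have : (List.map g l).head? = some (g x) ↔ l.head? = some x := by
      rw [List.head?_map]
      rw [← Option.map_some (f := g), (Option.map_injective hg).eq_iff]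
    simp only [this]
    split_ifs <;> rfl

theorem collapse_map_collapse (g : FOElem G D → FOElem G D)
    (hm : ∀ e, e.isMark = true → (g e).isMark = true) (l : List (FOElem G D)) :
    collapse ((collapse l).map g) = collapse (l.map g) := by
  induction l with
  | nil => rfl
  | cons x l ih =>
    rw [collapse_cons x l, List.map_cons]
    split_ifs with h
    · rw [ih, collapse_cons, if_pos]
      refine ⟨?_, hm _ h.2⟩
      rw [List.head?_map, h.1]; rfl
    · rw [List.map_cons, collapse_cons, collapse_cons, ih, List.head?_map, List.head?_map,
        head_collapse]

theorem collapse_chain (l : List (FOElem G D)) (x : FOElem G D) (t : List (FOElem G D))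
    (h : collapse l = x :: t) : x.isMark = true → t.head? ≠ some x := by
  induction l generalizing x t with
  | nil => simp [collapse] at h
  | cons y l ih =>
    rw [collapse_cons] at h
    split_ifs at h with h1
    · exact ih x t h
    · intro hm hx
      obtain ⟨rfl, rfl⟩ := List.cons.inj h
      rw [head_collapse] at hx
      exact h1 ⟨hx, hm⟩

theorem collapse_tail (l : List (FOElem G D)) (x : FOElem G D) (t : List (FOElem G D))
    (h : collapse l = x :: t) : ∃ l', collapse l' = t := by
  induction l generalizing x t with
  | nil => simp [collapse] at h
  | cons y l ih =>
    rw [collapse_cons] at h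
    split_ifs at h with h1
    · exact ih x t h
    · obtain ⟨rfl, rfl⟩ := List.cons.inj h
      exact ⟨l, rfl⟩

theorem mem_collapse (l : List (FOElem G D)) (x : FOElem G D)
    (h : x ∈ collapse l) : x ∈ l := by
  induction l with
  | nil => simp [collapse] at h
  | cons y l ih =>
    rw [collapse_cons] at h
    split_ifs at h with h1
    · exact List.mem_cons_of_mem _ (ih h)
    · rcases List.mem_cons.1 h with h | h
      · subst h; simp
      · exact List.mem_cons_of_mem _ (ih h)

/-- Retain triples with origin at most `n`, everything else is `right`. -/
def gR (n : ℤ) : FOElem G D → FOElem G D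
  | .tri g d o => if o ≤ n then .tri g d o else .right
  | .left => .left
  | .middle => .middle
  | .right => .right

/-- Triples with origin at most `n` become `left`. -/
def gL (n : ℤ) : FOElem G D → FOElem G D
  | .tri g d o => if o ≤ n then .left else .tri g d o
  | .left => .left
  | .middle => .middle
  | .right => .right

theorem gR_mark (n : ℤ) (e : FOElem G D) (h : e.isMark = true) : (gR n e).isMark = true := by
  cases e <;> simp_all [gR, FOElem.isMark, FOElem.isTri]

theorem gL_mark (n : ℤ) (e : FOElem G D) (h : e.isMark = true) : (gL n e).isMark = true := by
  cases e <;> simp_all [gL, FOElem.isMark, FOElem.isTri]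

theorem el_eq (n : ℤ) (a b : FOElem G D) (ha : a ≠ .left ∧ a ≠ .middle)
    (hb : b ≠ .left ∧ b ≠ .middle) (e1 : gR n a = gR n b) (e2 : gL n a = gL n b) : a = b := by
  cases a with
  | left => exact absurd rfl ha.1
  | middle => exact absurd rfl ha.2
  | right =>
    cases b with
    | left => exact absurd rfl hb.1
    | middle => exact absurd rfl hb.2
    | right => rfl
    | tri g d o => simp only [gL] at e2; split_ifs at e2
  | tri g d o =>
    cases b with
    | left => exact absurd rfl hb.1
    | middle => exact absurd rfl hb.2
    | right => simp only [gL] at e2; split_ifs at e2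
    | tri g' d' o' =>
      simp only [gL] at e2; simp only [gR] at e1
      split_ifs at e1 e2
      · exact e1
      · exact e2

theorem el_mark (n : ℤ) (a : FOElem G D) (ha : a ≠ .left ∧ a ≠ .middle)
    (h : (gR n a).isMark = true) : gR n a = .right ∧ gL n a = a := by
  cases a with
  | left => exact absurd rfl ha.1
  | middle => exact absurd rfl ha.2
  | right => exact ⟨rfl, rfl⟩
  | tri g d o =>
    simp only [gL, gR] at *
    split_ifs at h ⊢
    · exact absurd h (by simp [FOElem.isMark, FOElem.isTri])
    · exact ⟨rfl, rfl⟩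

theorem el_notmark (n : ℤ) (a : FOElem G D)
    (h : ¬ (gR n a).isMark = true) : gL n a = .left := by
  cases a with
  | left => rfl
  | middle => exact absurd rfl h
  | right => exact absurd rfl h
  | tri g d o =>
    simp only [gL, gR] at *
    split_ifs at h ⊢
    · rfl
    · exact absurd rfl h

theorem el_pre (n : ℤ) (a c : FOElem G D) (ha : a ≠ .left ∧ a ≠ .middle)
    (hm : a.isMark = true) (h : gL n c = a) : c = a := by
  subst h
  cases c with
  | left => rfl
  | middle => rfl
  | right => rfl
  | tri g d o =>
    simp only [gL] at *
    split_ifs at ha hm ⊢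
    · exact absurd rfl ha.1
    · rfl

theorem el_R (n : ℤ) (p q : FOElem G D) (hp : p ≠ .left ∧ p ≠ .middle)
    (hq : q ≠ .left ∧ q ≠ .middle) (h : gL n p = gL n q) (hr : gR n p = .right) :
    gR n q = .right := by
  have h1 := (el_mark n p hp (by rw [hr]; rfl)).2
  by_cases hm : (gR n q).isMark = true
  · exact (el_mark n q hq hm).1
  · rw [h1, el_notmark n q hm] at h
    exact absurd h hp.1

theorem el_L (n : ℤ) (p q : FOElem G D) (hp : p ≠ .left ∧ p ≠ .middle)
    (hq : q ≠ .left ∧ q ≠ .middle) (h : gR n p = gR n q) (hr : gL n p = .left) :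
    gL n q = .left := by
  by_cases hm : (gR n p).isMark = true
  · rw [(el_mark n p hp hm).2] at hr
    exact absurd hr hp.1
  · exact el_notmark n q (by rwa [← h])

/-- Reconstruction lemma. -/
theorem reconstruct (n : ℤ) (s t : List (FOElem G D))
    (hs : ∃ l, collapse l = s) (ht : ∃ l, collapse l = t)
    (hs' : ∀ e ∈ s, e ≠ .left ∧ e ≠ .middle) (ht' : ∀ e ∈ t, e ≠ .left ∧ e ≠ .middle)
    (h1 : collapse (s.map (gR n)) = collapse (t.map (gR n)))
    (h2 : collapse (s.map (gL n)) = collapse (t.map (gL n))) : s = t := by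
  induction s generalizing t with
  | nil =>
    have := congrArg List.head? h1
    rw [head_collapse, head_collapse] at this
    cases t with
    | nil => rfl
    | cons b t => simp at this
  | cons a s ih =>
    have e1 := congrArg List.head? h1
    have e2 := congrArg List.head? h2
    rw [head_collapse, head_collapse] at e1 e2
    cases t with
    | nil => simp at e1
    | cons b t =>
      simp only [List.map_cons, List.head?_cons, Option.some.injEq] at e1 e2
      have ha := hs' a (by simp)
      have hb := ht' b (by simp)
      have hab : a = b := el_eq n a b ha hb e1 e2
      subst hab
      congr 1
      obtain ⟨ls, hls⟩ := hs
      obtain ⟨lt, hlt⟩ := ht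
      have cs := collapse_chain _ _ _ hls
      have ct := collapse_chain _ _ _ hlt
      have hs'' : ∀ e ∈ s, e ≠ .left ∧ e ≠ .middle := fun e he => hs' e (by simp [he])
      have ht'' : ∀ e ∈ t, e ≠ .left ∧ e ≠ .middle := fun e he => ht' e (by simp [he])
      have hds : ∀ c, s.head? = some c → c ≠ .left ∧ c ≠ .middle := fun c hc =>
        hs'' c (List.mem_of_mem_head? hc)
      have hdt : ∀ c, t.head? = some c → c ≠ .left ∧ c ≠ .middle := fun c hc =>
        ht'' c (List.mem_of_mem_head? hc)
      rw [List.map_cons, List.map_cons] at h1 h2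
      have key : collapse (s.map (gR n)) = collapse (t.map (gR n)) ∧
          collapse (s.map (gL n)) = collapse (t.map (gL n)) := by
        by_cases hL : (gR n a).isMark = true
        · -- `a` is not a left triple
          obtain ⟨hga, hla⟩ := el_mark n a ha hL
          have k2 : collapse (s.map (gL n)) = collapse (t.map (gL n)) := by
            apply collapse_cons_inj _ _ _ _ h2
            intro hm
            rw [hla] at hm ⊢
            have aux : ∀ (l : List (FOElem G D)), (∀ c, l.head? = some c → c ≠ .left ∧ c ≠ .middle) →
                l.head? ≠ some a → (List.map (gL n) l).head? ≠ some a := by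
              intro l hl hne h
              rw [List.head?_map, Option.map_eq_some_iff] at h
              obtain ⟨c, hc, hc'⟩ := h
              exact hne (by rw [hc, el_pre n a c ha hm hc'])
            exact ⟨fun h => absurd h (aux s hds (cs hm)), fun h => absurd h (aux t hdt (ct hm))⟩
          refine ⟨?_, k2⟩
          apply collapse_cons_inj _ _ _ _ h1
          intro hm
          have e3 := congrArg List.head? k2
          rw [head_collapse, head_collapse, List.head?_map, List.head?_map] at e3
          rw [hga, List.head?_map, List.head?_map]
          have aux : ∀ p q : Option (FOElem G D), (∀ c, p = some c → c ≠ .left ∧ c ≠ .middle) →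
              (∀ c, q = some c → c ≠ .left ∧ c ≠ .middle) → p.map (gL n) = q.map (gL n) →
              p.map (gR n) = some .right → q.map (gR n) = some .right := by
            intro p q hp hq he hr
            cases p with
            | none => simp at hr
            | some p =>
              cases q with
              | none => simp at he
              | some q =>
                simp only [Option.map_some, Option.some.injEq] at he hr ⊢
                exact el_R n p q (hp p rfl) (hq q rfl) he hr
          exact ⟨aux _ _ hds hdt e3, aux _ _ hdt hds e3.symm⟩
        · have k1 : collapse (s.map (gR n)) = collapse (t.map (gR n)) :=
            collapse_cons_inj _ _ _ (fun h => absurd h hL) h1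
          refine ⟨k1, ?_⟩
          apply collapse_cons_inj _ _ _ _ h2
          intro hm
          have hla := el_notmark n a hL
          have e3 := congrArg List.head? k1
          rw [head_collapse, head_collapse, List.head?_map, List.head?_map] at e3
          rw [hla, List.head?_map, List.head?_map]
          have aux : ∀ p q : Option (FOElem G D), (∀ c, p = some c → c ≠ .left ∧ c ≠ .middle) →
              (∀ c, q = some c → c ≠ .left ∧ c ≠ .middle) → p.map (gR n) = q.map (gR n) →
              p.map (gL n) = some .left → q.map (gL n) = some .left := by
            intro p q hp hq he hr
            cases p with
            | none => simp at hr
            | some p =>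
              cases q with
              | none => simp at he
              | some q =>
                simp only [Option.map_some, Option.some.injEq] at he hr ⊢
                exact el_L n p q (hp p rfl) (hq q rfl) he hr
          exact ⟨aux _ _ hds hdt e3, aux _ _ hdt hds e3.symm⟩
      exact ih t (collapse_tail _ _ _ hls) (collapse_tail _ _ _ hlt) hs'' ht'' key.1 key.2

/-! ### Coarsenings of factored outputs -/

theorem three_of_left (f : Transduction A G D) (u v w : DataWord A D) :
    threeFac f u v w =
      collapse ((leftFac f u (v ++ w)).map (gR ((u.length + v.length : ℕ) : ℤ))) := by
  unfold threeFac leftFac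
  rw [collapse_map_collapse _ (gR_mark _), List.map_map, List.append_assoc]
  congr 1
  apply List.map_congr_left
  intro t _
  simp only [Function.comp]
  split_ifs with h1 h2
  · rfl
  · simp only [gR]; rw [if_pos (by exact_mod_cast h2)]
  · simp only [gR]; rw [if_neg (by exact_mod_cast h2)]

theorem three_of_right (f : Transduction A G D) (u v w : DataWord A D) :
    threeFac f u v w =
      collapse ((rightFac f (u ++ v) w).map (gL ((u.length : ℕ) : ℤ))) := by
  unfold threeFac rightFac
  rw [collapse_map_collapse _ (gL_mark _), List.map_map]
  congr 1
  apply List.map_congr_left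
  intro t _
  simp only [Function.comp, List.length_append]
  by_cases h1 : t.2.2 ≤ u.length
  · rw [if_pos h1, if_neg (by omega)]; simp only [gL]; rw [if_pos (by exact_mod_cast h1)]
  · rw [if_neg h1]
    by_cases h2 : t.2.2 ≤ u.length + v.length
    · rw [if_pos h2, if_neg (by omega)]; simp only [gL]; rw [if_neg (by exact_mod_cast h1)]
    · rw [if_neg h2, if_pos (by omega)]; rfl

theorem right_of_right (f : Transduction A G D) (u v w : DataWord A D) :
    rightFac f u (v ++ w) =
      collapse ((rightFac f (u ++ v) w).map (gR ((u.length : ℕ) : ℤ))) := by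
  unfold rightFac
  rw [collapse_map_collapse _ (gR_mark _), List.map_map, List.append_assoc]
  congr 1
  apply List.map_congr_left
  intro t _
  simp only [Function.comp, List.length_append]
  by_cases h1 : u.length < t.2.2
  · rw [if_pos h1]
    split_ifs with h2
    · rfl
    · simp only [gR]; rw [if_neg (by push Not; exact_mod_cast h1)]
  · rw [if_neg h1, if_neg (by omega)]
    simp only [gR]; rw [if_pos (by push Not at h1; exact_mod_cast h1)]

theorem left_of_left (f : Transduction A G D) (u v w : DataWord A D) :
    leftFac f (u ++ v) w =
      collapse ((leftFac f u (v ++ w)).map (gL ((u.length + v.length : ℕ) : ℤ))) := by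
  unfold leftFac
  rw [collapse_map_collapse _ (gL_mark _), List.map_map, List.append_assoc]
  congr 1
  apply List.map_congr_left
  intro t _
  simp only [Function.comp, List.length_append]
  by_cases h1 : t.2.2 ≤ u.length
  · rw [if_pos (by omega), if_pos h1]; rfl
  · rw [if_neg h1]
    simp only [gL]
    by_cases h2 : t.2.2 ≤ u.length + v.length
    · rw [if_pos h2, if_pos (by exact_mod_cast h2)]
    · rw [if_neg h2, if_neg (by exact_mod_cast h2)]

theorem right_no_left (f : Transduction A G D) (u w : DataWord A D) :
    ∀ e ∈ rightFac f u w, e ≠ .left ∧ e ≠ .middle := by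
  intro e he
  have := mem_collapse _ _ he
  simp only [List.mem_map] at this
  obtain ⟨t, _, rfl⟩ := this
  split_ifs <;> simp

theorem right_eq_iff (f : Transduction A G D) (u y v₁ v₂ : DataWord A D) :
    rightFac f (u ++ y) v₁ = rightFac f (u ++ y) v₂ ↔
      rightFac f u (y ++ v₁) = rightFac f u (y ++ v₂) ∧
      threeFac f u y v₁ = threeFac f u y v₂ := by
  constructor
  · intro h
    rw [right_of_right, right_of_right, three_of_right, three_of_right, h]
    exact ⟨rfl, rfl⟩
  · rintro ⟨h1, h2⟩
    rw [right_of_right, right_of_right] at h1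
    rw [three_of_right, three_of_right] at h2
    exact reconstruct _ _ _ ⟨_, rfl⟩ ⟨_, rfl⟩ (right_no_left _ _ _) (right_no_left _ _ _) h1 h2

end aux2
end SSRT

namespace SSRT
section aux3
variable {A G D : Type} [DecidableEq G] [DecidableEq D]

/-! ### Equivariance -/

theorem collapse_permFO (π : Equiv.Perm D) (l : List (FOElem G D)) :
    collapse (permFO π l) = permFO π (collapse l) := by
  apply collapse_map_inj
  · intro a b h
    cases a <;> cases b <;> simp_all
  · intro e; cases e <;> rfl

theorem collapse_foShift (z : ℤ) (l : List (FOElem G D)) :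
    collapse (foShift z l) = foShift z (collapse l) := by
  apply collapse_map_inj
  · intro a b h
    cases a <;> cases b <;> simp_all
  · intro e; cases e <;> rfl

theorem leftFac_perm {f : Transduction A G D} (hf : PermInvariant f) (π : Equiv.Perm D)
    (u v : DataWord A D) :
    leftFac f (permW π u) (permW π v) = permFO π (leftFac f u v) := by
  unfold leftFac
  rw [← permW_append, hf, ← collapse_permFO]
  simp only [permOut, permFO, List.map_map, permW_length]
  congr 1
  apply List.map_congr_left
  intro t _
  simp only [Function.comp]
  split_ifs <;> rfl

theorem rightFac_perm {f : Transduction A G D} (hf : PermInvariant f) (π : Equiv.Perm D)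
    (u v : DataWord A D) :
    rightFac f (permW π u) (permW π v) = permFO π (rightFac f u v) := by
  unfold rightFac
  rw [← permW_append, hf, ← collapse_permFO]
  simp only [permOut, permFO, List.map_map, permW_length]
  congr 1
  apply List.map_congr_left
  intro t _
  simp only [Function.comp]
  split_ifs <;> rfl

theorem threeFac_perm {f : Transduction A G D} (hf : PermInvariant f) (π : Equiv.Perm D)
    (u v w : DataWord A D) :
    threeFac f (permW π u) (permW π v) (permW π w) = permFO π (threeFac f u v w) := by
  unfold threeFac
  rw [← permW_append, ← permW_append, hf, ← collapse_permFO]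
  simp only [permOut, permFO, List.map_map, permW_length]
  congr 1
  apply List.map_congr_left
  intro t _
  simp only [Function.comp]
  split_ifs <;> rfl

theorem three_shift (f : Transduction A G D) (u₁ u₂ x w : DataWord A D)
    (h : foShift ((u₁.length : ℤ) - (u₂.length : ℤ)) (leftFac f u₂ (x ++ w))
      = leftFac f u₁ (x ++ w)) :
    foShift ((u₁.length : ℤ) - (u₂.length : ℤ)) (threeFac f u₂ x w) = threeFac f u₁ x w := by
  rw [three_of_left, three_of_left, ← h, ← collapse_foShift]
  congr 1
  simp only [foShift, List.map_map]
  apply List.map_congr_left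
  intro e _
  cases e with
  | left => rfl
  | middle => rfl
  | right => rfl
  | tri g d o =>
    simp only [Function.comp, gR]
    push_cast
    by_cases ho : o ≤ u₂.length + x.length
    · rw [if_pos ho, if_pos (by linarith)]
    · rw [if_neg ho, if_neg (by intro h; apply ho; linarith)]

/-- Data values of the right-factored output occur in the left part. -/
theorem rightFac_perm_self {f : Transduction A G D} (hp : NoDataPeeking f) (π : Equiv.Perm D)
    (u v : DataWord A D) (h : ∀ d, OccursIn d u → π d = d) :
    permFO π (rightFac f u v) = rightFac f u v := by
  unfold rightFac
  rw [← collapse_permFO]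
  congr 1
  simp only [permFO, List.map_map]
  apply List.map_congr_left
  intro t ht
  simp only [Function.comp]
  by_cases h1 : u.length < t.2.2
  · rw [if_pos h1]
  · rw [if_neg h1]
    obtain ⟨i, a, hi, hi'⟩ := hp _ t ht
    rw [List.getElem?_append_left (by omega)] at hi
    simp only [h t.2.1 ⟨_, List.mem_of_getElem? hi, rfl⟩]

/-! ### Characterizations of memorable and vulnerable values -/

theorem mem_char (f : Transduction A G D) (d : D) (u : DataWord A D) :
    Memorable f d u ↔ ∃ (v : DataWord A D) (d' : D), ¬ OccursIn d' u ∧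
      leftFac f (permW (Equiv.swap d d') u) v ≠ leftFac f u v := by
  constructor
  · rintro ⟨v, d', hs, h⟩
    rcases safe_cases _ _ _ hs with rfl | h1 | h1
    · rw [replaceD_same] at h; exact absurd rfl h
    · rw [replaceD_self _ _ _ h1] at h; exact absurd rfl h
    · exact ⟨v, d', h1, by rwa [replaceD_eq_swap _ _ _ h1] at h⟩
  · rintro ⟨v, d', h1, h⟩
    exact ⟨v, d', safe_of_fresh _ _ _ h1, by rwa [replaceD_eq_swap _ _ _ h1]⟩

theorem vul_char (f : Transduction A G D) (d : D) (u : DataWord A D) :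
    Vulnerable f d u ↔ ∃ (u' v : DataWord A D) (d' : D), ¬ OccursIn d u' ∧
      ¬ OccursIn d' (u ++ u' ++ v) ∧
      rightFac f (u ++ u') (permW (Equiv.swap d d') v) ≠ rightFac f (u ++ u') v := by
  constructor
  · rintro ⟨u', v, d', hd, hs, h⟩
    rcases safe_cases _ _ _ hs with rfl | h1 | h1
    · rw [replaceD_same] at h; exact absurd rfl h
    · rw [replaceD_self _ _ _ (fun h' => h1 ((occ_append _ _ _).2 (Or.inr h')))] at h
      exact absurd rfl h
    · refine ⟨u', v, d', hd, h1, ?_⟩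
      rwa [replaceD_eq_swap _ _ _ (fun h' => h1 ((occ_append _ _ _).2 (Or.inr h')))] at h
  · rintro ⟨u', v, d', hd, h1, h⟩
    refine ⟨u', v, d', hd, safe_of_fresh _ _ _ h1, ?_⟩
    rwa [replaceD_eq_swap _ _ _ (fun h' => h1 ((occ_append _ _ _).2 (Or.inr h')))]

theorem mem_occ {f : Transduction A G D} {d : D} {u : DataWord A D} (h : Memorable f d u) :
    OccursIn d u := by
  by_contra hc
  obtain ⟨v, d', h1, h⟩ := (mem_char _ _ _).1 h
  rw [permW_swap_self _ _ _ hc h1] at h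
  exact h rfl

theorem vul_occ {f : Transduction A G D} (hf : PermInvariant f) (hp : NoDataPeeking f)
    {d : D} {u : DataWord A D} (h : Vulnerable f d u) : OccursIn d u := by
  by_contra hc
  obtain ⟨u', v, d', hd, h1, h⟩ := (vul_char _ _ _).1 h
  have h2 : ¬ OccursIn d (u ++ u') := by rw [occ_append]; tauto
  have h3 : ¬ OccursIn d' (u ++ u') := by rw [occ_append] at h1; tauto
  apply h
  conv_lhs => rw [← permW_swap_self d d' (u ++ u') h2 h3]
  rw [rightFac_perm hf]
  apply rightFac_perm_self hp
  intro e he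
  apply Equiv.swap_apply_of_ne_of_ne
  · rintro rfl; exact h2 he
  · rintro rfl; exact h3 he

theorem ifl_occ {f : Transduction A G D} (hf : PermInvariant f) (hp : NoDataPeeking f)
    {d : D} {u : DataWord A D} (h : Influencing f d u) : OccursIn d u :=
  h.elim mem_occ (vul_occ hf hp)

theorem ifl_finite {f : Transduction A G D} (hf : PermInvariant f) (hp : NoDataPeeking f)
    (u : DataWord A D) : {d | Influencing f d u}.Finite := by
  apply Set.Finite.subset (u.map Prod.snd).toFinset.finite_toSet
  intro d hd
  have := ifl_occ hf hp hd
  rw [occ_iff] at this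
  simpa using this

theorem vul_finite {f : Transduction A G D} (hf : PermInvariant f) (hp : NoDataPeeking f)
    (u : DataWord A D) : {d | Vulnerable f d u}.Finite :=
  (ifl_finite hf hp u).subset fun _ h => Or.inr h

theorem swap_conj_permW (τ : Equiv.Perm D) (d d' : D) (u : DataWord A D) :
    permW (Equiv.swap (τ d) (τ d')) (permW τ u) = permW τ (permW (Equiv.swap d d') u) := by
  rw [← permW_mul, ← permW_mul]
  congr 1
  ext x
  simp only [Equiv.Perm.mul_apply]
  exact τ.injective.swap_apply d d' x

theorem mem_perm_mp {f : Transduction A G D} (hf : PermInvariant f) (τ : Equiv.Perm D)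
    {d : D} {u : DataWord A D} (h : Memorable f d u) : Memorable f (τ d) (permW τ u) := by
  rw [mem_char] at *
  obtain ⟨v, d', h1, h⟩ := h
  refine ⟨permW τ v, τ d', by rwa [occ_perm], ?_⟩
  rw [swap_conj_permW, leftFac_perm hf, leftFac_perm hf]
  rwa [Ne, permFO_inj]

theorem vul_perm_mp {f : Transduction A G D} (hf : PermInvariant f) (τ : Equiv.Perm D)
    {d : D} {u : DataWord A D} (h : Vulnerable f d u) : Vulnerable f (τ d) (permW τ u) := by
  rw [vul_char] at *
  obtain ⟨u', v, d', hd, h1, h⟩ := h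
  refine ⟨permW τ u', permW τ v, τ d', by rwa [occ_perm], ?_, ?_⟩
  · rwa [← permW_append, ← permW_append, occ_perm]
  · rw [swap_conj_permW, ← permW_append, rightFac_perm hf, rightFac_perm hf]
    rwa [Ne, permFO_inj]

theorem ifl_perm_mp {f : Transduction A G D} (hf : PermInvariant f) (τ : Equiv.Perm D)
    {d : D} {u : DataWord A D} (h : Influencing f d u) : Influencing f (τ d) (permW τ u) :=
  h.imp (mem_perm_mp hf τ) (vul_perm_mp hf τ)

theorem ifl_perm {f : Transduction A G D} (hf : PermInvariant f) (τ : Equiv.Perm D)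
    (d : D) (u : DataWord A D) : Influencing f (τ d) (permW τ u) ↔ Influencing f d u := by
  refine ⟨fun h => ?_, ifl_perm_mp hf τ⟩
  have := ifl_perm_mp hf τ⁻¹ h
  rw [← permW_mul, inv_mul_cancel, permW_one] at this
  simpa using this

theorem lastOcc_perm (τ : Equiv.Perm D) (u : DataWord A D) (d : D) (i : ℕ)
    (h : IsLastOcc u d i) : IsLastOcc (permW τ u) (τ d) i := by
  obtain ⟨⟨a, ha⟩, h2⟩ := h
  refine ⟨⟨a, by simp [permW, ha]⟩, ?_⟩
  intro j hj p hp
  simp only [permW, List.getElem?_map, Option.map_eq_some_iff] at hp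
  obtain ⟨q, hq, rfl⟩ := hp
  intro h
  exact h2 j hj q hq (τ.injective h)

theorem fresher_perm (τ : Equiv.Perm D) (u : DataWord A D) (d e : D)
    (h : Fresher u d e) : Fresher (permW τ u) (τ d) (τ e) := by
  obtain ⟨i, j, h1, h2, h3⟩ := h
  exact ⟨i, j, lastOcc_perm _ _ _ _ h1, lastOcc_perm _ _ _ _ h2, h3⟩

theorem iflSeq_iff (f : Transduction A G D) (u : DataWord A D) (l : List D) :
    IsIflSeq f u l ↔ (∀ d, d ∈ l ↔ Influencing f d u) ∧ l.Nodup ∧ l.Pairwise (Fresher u) := by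
  unfold IsIflSeq
  rw [List.pairwise_iff_get]
  refine and_congr Iff.rfl (and_congr Iff.rfl ?_)
  constructor
  · intro h i j hij
    exact h i j i.2 j.2 hij
  · intro h i j hi hj hij
    exact h ⟨i, hi⟩ ⟨j, hj⟩ hij

theorem iflSeq_perm {f : Transduction A G D} (hf : PermInvariant f) (τ : Equiv.Perm D)
    (u : DataWord A D) (l : List D) (h : IsIflSeq f u l) :
    IsIflSeq f (permW τ u) (l.map τ) := by
  rw [iflSeq_iff] at *
  obtain ⟨h1, h2, h3⟩ := h
  refine ⟨?_, h2.map τ.injective, ?_⟩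
  · intro d
    obtain ⟨e, rfl⟩ := τ.surjective d
    rw [ifl_perm hf, ← h1]
    simp
  · rw [List.pairwise_map]
    exact h3.imp (fun h => fresher_perm _ _ _ _ h)

/-! ### Lemma B: permuting the right part -/

theorem lemmaB [Infinite D] {f : Transduction A G D} (hf : PermInvariant f)
    (hp : NoDataPeeking f) (u v : DataWord A D) (τ : Equiv.Perm D)
    (hτ : ∀ d, Vulnerable f d u → τ d = d) :
    rightFac f u (permW τ v) = rightFac f u v := by
  have base : ∀ (x c : D) (w : DataWord A D), ¬ Vulnerable f x u → ¬ OccursIn c (u ++ w) →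
      rightFac f u (permW (Equiv.swap x c) w) = rightFac f u w := by
    intro x c w hx hc
    by_contra hne
    apply hx
    rw [vul_char]
    refine ⟨[], w, c, by simp [OccursIn], by simpa using hc, by simpa using hne⟩
  refine perm_generic {d | Vulnerable f d u} (vul_finite hf hp u)
    (fun w => rightFac f u w = rightFac f u v) ?_ τ hτ v rfl
  intro w x y hw hx hy hyw
  rw [← hw]
  by_cases hyx : y = x
  · subst hyx
    rw [Equiv.swap_self]
    exact congrArg _ (permW_one w)
  obtain ⟨c, hc⟩ := exists_fresh (x :: y :: (u ++ w).map Prod.snd)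
  simp only [List.mem_cons, not_or] at hc
  obtain ⟨hcx, hcy, hc⟩ := hc
  rw [← occ_iff] at hc
  rw [← base x c w hx hc]
  rw [← base y c (permW (Equiv.swap x y) w) hy ?_]
  · congr 1
    rw [← permW_mul]
    unfold permW
    apply List.map_congr_left
    intro p hp'
    have h2 : p.2 ≠ y := fun h => hyw ⟨p, hp', h⟩
    have h3 : p.2 ≠ c := fun h => hc ((occ_append _ _ _).2 (Or.inr ⟨p, hp', h⟩))
    simp only [Prod.mk.injEq, true_and, Equiv.Perm.mul_apply]
    by_cases h1 : p.2 = x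
    · rw [h1]; simp
    · rw [Equiv.swap_apply_of_ne_of_ne h1 h2, Equiv.swap_apply_of_ne_of_ne h2 h3,
        Equiv.swap_apply_of_ne_of_ne h1 h3]
  · rw [occ_append] at hc ⊢
    have := occ_perm (Equiv.swap x y) c w
    rw [Equiv.swap_apply_of_ne_of_ne hcx hcy] at this
    rwa [this]

/-! ### Similarity of left parts -/

/-- `u₁` and `u₂` are interchangeable as left parts. -/
def Sim (f : Transduction A G D) (u₁ u₂ : DataWord A D) : Prop :=
  u₁.length = u₂.length ∧ (∀ v, leftFac f u₁ v = leftFac f u₂ v) ∧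
  ∀ y v₁ v₂, (rightFac f (u₁ ++ y) v₁ = rightFac f (u₁ ++ y) v₂ ↔
    rightFac f (u₂ ++ y) v₁ = rightFac f (u₂ ++ y) v₂)

theorem Sim.rfl' (f : Transduction A G D) (u : DataWord A D) : Sim f u u :=
  ⟨rfl, fun _ => rfl, fun _ _ _ => Iff.rfl⟩

theorem Sim.symm' {f : Transduction A G D} {u₁ u₂ : DataWord A D} (h : Sim f u₁ u₂) :
    Sim f u₂ u₁ :=
  ⟨h.1.symm, fun v => (h.2.1 v).symm, fun y a b => (h.2.2 y a b).symm⟩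

theorem Sim.trans' {f : Transduction A G D} {u₁ u₂ u₃ : DataWord A D} (h : Sim f u₁ u₂)
    (h' : Sim f u₂ u₃) : Sim f u₁ u₃ :=
  ⟨h.1.trans h'.1, fun v => (h.2.1 v).trans (h'.2.1 v),
    fun y a b => (h.2.2 y a b).trans (h'.2.2 y a b)⟩

theorem Sim.three {f : Transduction A G D} {u₁ u₂ : DataWord A D} (h : Sim f u₁ u₂)
    (x w : DataWord A D) : threeFac f u₁ x w = threeFac f u₂ x w := by
  rw [three_of_left, three_of_left, h.1, h.2.1]

theorem Sim.append {f : Transduction A G D} {u₁ u₂ : DataWord A D} (h : Sim f u₁ u₂)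
    (x : DataWord A D) : Sim f (u₁ ++ x) (u₂ ++ x) := by
  refine ⟨by simp [h.1], ?_, ?_⟩
  · intro v
    rw [left_of_left, left_of_left, h.1, h.2.1]
  · intro y a b
    rw [List.append_assoc, List.append_assoc]
    exact h.2.2 _ _ _

theorem sim_step [Infinite D] {f : Transduction A G D} (hf : PermInvariant f)
    (hp : NoDataPeeking f) (u : DataWord A D) (x c : D) (hx : ¬ Influencing f x u)
    (hc : ¬ OccursIn c u) : Sim f u (permW (Equiv.swap x c) u) := by
  have hleft : ∀ v, leftFac f u v = leftFac f (permW (Equiv.swap x c) u) v := by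
    intro v
    by_contra hne
    exact hx (Or.inl ((mem_char _ _ _).2 ⟨v, c, hc, fun h => hne h.symm⟩))
  refine ⟨(permW_length _ _).symm, hleft, ?_⟩
  have hright : ∀ v, rightFac f (permW (Equiv.swap x c) u) v =
      permFO (Equiv.swap x c) (rightFac f u v) := by
    intro v
    conv_lhs => rw [← permW_swap_swap x c v]
    rw [rightFac_perm hf, lemmaB hf hp]
    intro d hd
    apply Equiv.swap_apply_of_ne_of_ne
    · rintro rfl; exact hx (Or.inr hd)
    · rintro rfl; exact hc (vul_occ hf hp hd)
  intro y v₁ v₂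
  rw [right_eq_iff, right_eq_iff, hright, hright, permFO_inj]
  rw [three_of_left f u, three_of_left f u, three_of_left f (permW _ u),
    three_of_left f (permW _ u), hleft, hleft, permW_length]

theorem sim_perm [Infinite D] {f : Transduction A G D} (hf : PermInvariant f)
    (hp : NoDataPeeking f) (u : DataWord A D) (τ : Equiv.Perm D)
    (hτ : ∀ d, Influencing f d u → τ d = d) : Sim f u (permW τ u) := by
  refine (perm_generic {d | Influencing f d u} (ifl_finite hf hp u)
    (fun w => Sim f u w ∧ ∀ d, Influencing f d w → Influencing f d u) ?_ τ hτ u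
    ⟨Sim.rfl' f u, fun _ h => h⟩).1
  rintro w x y ⟨hw, hi⟩ hx hy hyw
  refine ⟨hw.trans' (sim_step hf hp w x y (fun h => hx (hi x h)) hyw), ?_⟩
  intro d hd
  obtain ⟨e, rfl⟩ := (Equiv.swap x y).surjective d
  rw [ifl_perm hf] at hd
  have := hi e hd
  rwa [Equiv.swap_apply_of_ne_of_ne]
  · rintro rfl; exact hx this
  · rintro rfl; exact hy this

theorem mem_indep {f : Transduction A G D} (hf : PermInvariant f) (u : DataWord A D)
    (d d' e : D) (h' : ¬ OccursIn d' u) (he : ¬ OccursIn e u) (hd : OccursIn d u)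
    (h : ∀ v, leftFac f (permW (Equiv.swap d e) u) v = leftFac f u v) (v : DataWord A D) :
    leftFac f (permW (Equiv.swap d d') u) v = leftFac f u v := by
  have hd' : d ≠ d' := by rintro rfl; exact h' hd
  have hde : d ≠ e := by rintro rfl; exact he hd
  have hu : permW (Equiv.swap e d') u = u := permW_swap_self _ _ _ he h'
  have h1 := swap_conj_permW (Equiv.swap e d') d e u
  rw [hu, Equiv.swap_apply_left, Equiv.swap_apply_of_ne_of_ne hde hd'] at h1
  rw [h1]
  conv_lhs => rw [← permW_swap_swap e d' v]
  rw [leftFac_perm hf, h, ← leftFac_perm hf, permW_swap_swap, hu]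

theorem Sim.mem [Infinite D] {f : Transduction A G D} (hf : PermInvariant f)
    {u₁ u₂ : DataWord A D} (hs : Sim f u₁ u₂) {d : D} (h : Memorable f d u₁) :
    Memorable f d u₂ := by
  by_contra hn
  have hocc := mem_occ h
  obtain ⟨v, d', h1, h⟩ := (mem_char _ _ _).1 h
  obtain ⟨e, he⟩ := exists_fresh ((u₁ ++ u₂).map Prod.snd)
  rw [← occ_iff, occ_append, not_or] at he
  apply h
  apply mem_indep hf u₁ d d' e h1 he.1 hocc
  intro w
  have h2 : leftFac f (permW (Equiv.swap d e) u₂) w = leftFac f u₂ w := by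
    by_contra hne
    exact hn ((mem_char _ _ _).2 ⟨w, e, he.2, hne⟩)
  rw [hs.2.1 w, ← h2]
  conv_lhs => rw [← permW_swap_swap d e w]
  conv_rhs => rw [← permW_swap_swap d e w]
  rw [leftFac_perm hf, leftFac_perm hf, hs.2.1]

theorem Sim.vul [Infinite D] {f : Transduction A G D} (hf : PermInvariant f)
    (hp : NoDataPeeking f)
    {u₁ u₂ : DataWord A D} (hs : Sim f u₁ u₂) {d : D} (h : Vulnerable f d u₁) :
    Vulnerable f d u₂ := by
  have hocc := vul_occ hf hp h
  obtain ⟨u', v, d', hd, h1, h⟩ := (vul_char _ _ _).1 h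
  obtain ⟨e, he⟩ := exists_fresh ((u₁ ++ u' ++ v ++ u₂).map Prod.snd)
  rw [← occ_iff] at he
  simp only [occ_append, not_or] at he h1
  rw [vul_char]
  refine ⟨u', v, e, hd, by simp only [occ_append]; tauto, ?_⟩
  rw [Ne, ← hs.2.2]
  have hdd' : d ≠ d' := by rintro rfl; exact h1.1.1 hocc
  have hde : d ≠ e := by rintro rfl; exact he.1.1.1 hocc
  have hv : permW (Equiv.swap d' e) v = v := permW_swap_self _ _ _ h1.2 he.1.2
  have hu : permW (Equiv.swap d' e) (u₁ ++ u') = u₁ ++ u' :=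
    permW_swap_self _ _ _ (by rw [occ_append]; tauto) (by rw [occ_append]; tauto)
  have h3 := swap_conj_permW (Equiv.swap d' e) d d' v
  rw [hv, Equiv.swap_apply_left, Equiv.swap_apply_of_ne_of_ne hdd' hde] at h3
  rw [h3]
  conv =>
    congr
    lhs
    rw [← hu]
  rw [rightFac_perm hf, rightFac_perm_self hp]
  · exact h
  · intro a ha
    apply Equiv.swap_apply_of_ne_of_ne
    · rintro rfl; rw [occ_append] at ha; tauto
    · rintro rfl; rw [occ_append] at ha; tauto

theorem Sim.ifl [Infinite D] {f : Transduction A G D} (hf : PermInvariant f)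
    (hp : NoDataPeeking f)
    {u₁ u₂ : DataWord A D} (hs : Sim f u₁ u₂) (d : D) :
    Influencing f d u₁ ↔ Influencing f d u₂ :=
  ⟨fun h => h.imp (hs.mem hf) (hs.vul hf hp),
    fun h => h.imp (hs.symm'.mem hf) (hs.symm'.vul hf hp)⟩

/-! ### Influencing values of one-letter extensions -/

theorem ifl_snoc_mem {f : Transduction A G D} (u : DataWord A D) (σ : A) (d e : D)
    (hne : e ≠ d) (h : Influencing f e (u ++ [(σ, d)])) : Influencing f e u := by
  have hnd : ¬ OccursIn e [(σ, d)] := by simpa [OccursIn] using hne.symm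
  rcases h with h | h
  · left
    rw [mem_char] at *
    obtain ⟨v, d', h1, h⟩ := h
    rw [occ_append, not_or] at h1
    refine ⟨[(σ, d)] ++ v, d', h1.1, fun heq => h ?_⟩
    rw [permW_append, permW_swap_self _ _ _ hnd h1.2, left_of_left, left_of_left, heq,
      permW_length]
  · right
    rw [vul_char] at *
    obtain ⟨u', v, d', hd, h1, h⟩ := h
    refine ⟨[(σ, d)] ++ u', v, d', by rw [occ_append]; tauto, ?_, ?_⟩
    · simpa using h1
    · simpa using h

theorem exists_lastOcc (u : DataWord A D) (d : D) (h : OccursIn d u) :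
    ∃ i, IsLastOcc u d i := by
  induction u using List.reverseRecOn with
  | nil => simp [OccursIn] at h
  | append_singleton u p ih =>
    by_cases hp : p.2 = d
    · refine ⟨u.length, ⟨p.1, ?_⟩, ?_⟩
      · simp [← hp]
      · intro j hj q hq
        rw [List.getElem?_eq_none (by simp; omega)] at hq
        exact absurd hq (by simp)
    · have h' : OccursIn d u := by
        rcases (occ_append _ _ _).1 h with h | h
        · exact h
        · simp [OccursIn] at h; exact absurd h hp
      obtain ⟨i, ⟨a, ha⟩, hi⟩ := ih h'
      have hil : i < u.length := (List.getElem?_eq_some_iff.1 ha).1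
      refine ⟨i, ⟨a, by rw [List.getElem?_append_left hil, ha]⟩, ?_⟩
      intro j hj q hq
      by_cases hjl : j < u.length
      · rw [List.getElem?_append_left hjl] at hq
        exact hi j hj q hq
      · rw [List.getElem?_append_right (by omega)] at hq
        have : q ∈ [p] := List.mem_of_getElem? hq
        simp only [List.mem_singleton] at this
        rwa [this]

theorem lastOcc_snoc (u : DataWord A D) (σ : A) (d e : D) (hne : e ≠ d) (i : ℕ)
    (h : IsLastOcc u e i) : IsLastOcc (u ++ [(σ, d)]) e i := by
  obtain ⟨⟨a, ha⟩, hi⟩ := h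
  have hil : i < u.length := (List.getElem?_eq_some_iff.1 ha).1
  refine ⟨⟨a, by rw [List.getElem?_append_left hil, ha]⟩, ?_⟩
  intro j hj q hq
  by_cases hjl : j < u.length
  · rw [List.getElem?_append_left hjl] at hq
    exact hi j hj q hq
  · rw [List.getElem?_append_right (by omega)] at hq
    have : q ∈ [(σ, d)] := List.mem_of_getElem? hq
    simp only [List.mem_singleton] at this
    rw [this]
    exact hne.symm

open Classical in
/-- The influencing sequence of a one-letter extension. -/
theorem iflSeq_snoc {f : Transduction A G D} (hf : PermInvariant f) (hp : NoDataPeeking f)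
    (u : DataWord A D) (σ : A) (d : D) (l : List D) (h : IsIflSeq f u l) :
    IsIflSeq f (u ++ [(σ, d)]) ((d :: l.filter (fun e => decide (e ≠ d))).filter
      (fun e => decide (Influencing f e (u ++ [(σ, d)])))) := by
  rw [iflSeq_iff] at *
  obtain ⟨h1, h2, h3⟩ := h
  refine ⟨?_, ?_, ?_⟩
  · intro e
    simp only [List.mem_filter, List.mem_cons, decide_eq_true_eq]
    constructor
    · exact fun h => h.2
    · intro h
      refine ⟨?_, h⟩
      by_cases hed : e = d
      · exact Or.inl hed
      · exact Or.inr ⟨(h1 e).2 (ifl_snoc_mem u σ d e hed h), hed⟩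
  · apply List.Nodup.filter
    rw [List.nodup_cons]
    exact ⟨by simp, h2.filter _⟩
  · apply List.Pairwise.filter
    rw [List.pairwise_cons]
    constructor
    · intro e he
      simp only [List.mem_filter, decide_eq_true_eq] at he
      obtain ⟨i, hi⟩ := exists_lastOcc u e (ifl_occ hf hp ((h1 e).1 he.1))
      have hil : i < u.length := by
        obtain ⟨a, ha⟩ := hi.1
        exact (List.getElem?_eq_some_iff.1 ha).1
      refine ⟨u.length, i, ⟨⟨σ, by simp⟩, ?_⟩, lastOcc_snoc u σ d e he.2 i hi, hil⟩
      intro j hj q hq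
      rw [List.getElem?_eq_none (by simp; omega)] at hq
      exact absurd hq (by simp)
    · rw [List.pairwise_filter]
      apply h3.imp
      rintro a b ⟨i, j, hi, hj, hij⟩ ha hb
      simp only [decide_eq_true_eq] at ha hb
      exact ⟨i, j, lastOcc_snoc _ _ _ _ ha _ hi, lastOcc_snoc _ _ _ _ hb _ hj, hij⟩

end aux3
end SSRT

namespace SSRT
section aux4
variable {A G D : Type} [DecidableEq G] [DecidableEq D]

theorem exists_aifl (f : Transduction A G D) (u : DataWord A D) (l : List D)
    (h : IsIflSeq f u l) : ∃ al, IsAiflSeq f u al ∧ al.map Prod.fst = l := by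
  classical
  refine ⟨l.map fun d => (d, if Memorable f d u then
    (if Vulnerable f d u then IflType.vm else IflType.m) else IflType.v), ?_, ?_⟩
  · refine ⟨by simpa [Function.comp_def] using h, ?_⟩
    intro p hp
    rw [List.mem_map] at hp
    obtain ⟨d, hd, rfl⟩ := hp
    have hi := (h.1 d).1 hd
    by_cases h1 : Memorable f d u
    · by_cases h2 : Vulnerable f d u
      · simp only [h1, h2, if_true]; exact ⟨h1, h2⟩
      · simp only [h1, h2, if_true, if_false]; exact ⟨h1, h2⟩
    · simp only [h1, if_false]; exact ⟨hi.resolve_left h1, h1⟩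
  · simp [Function.comp_def]

theorem equalize {f : Transduction A G D} (hf : PermInvariant f)
    {E : DataWord A D → Equiv.Perm D} {δ : ℕ → D} (hE : IsEqualizingSchemeWith f E δ)
    (u : DataWord A D) (l : List D) (h : IsIflSeq f u l) (i : ℕ) (hi : i < l.length) :
    E u l[i] = δ (i + 1) := by
  have := hE u _ (iflSeq_perm hf (E u) u l h) i (by simpa using hi)
  simpa using this

end aux4
end SSRT

open SSRT

/-- Lemma 15.  Here `dd 0` plays the role of `d_0`
(not `f`-influencing in `u`), `δ 0` plays the role of `δ_0`, and the pair
`(d, η)` is `(dd k, δ k)` for some `k ≤ m`. -/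
theorem compute_left_blocks
    {D A G : Type} [DecidableEq D] [Infinite D] [DecidableEq G]
    [Fintype A] [Fintype G]
    (f : Transduction A G D)
    (hperm : PermInvariant f) (hpeek : NoDataPeeking f)
    (E : DataWord A D → Equiv.Perm D) (δ : ℕ → D)
    (hE : IsEqualizingSchemeWith f E δ)
    (u u' v : DataWord A D) (σ : A)
    (m : ℕ) (dd : ℕ → D)
    (hifl : IsIflSeq f u ((List.range m).map fun k => dd (k + 1)))
    (hd0 : ∀ i : ℕ, 1 ≤ i → i ≤ m → dd 0 ≠ dd i)
    (hδ0 : ∀ i : ℕ, 1 ≤ i → i ≤ m → δ 0 ≠ δ i)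
    (k : ℕ) (hk : k ≤ m)
    (π : Equiv.Perm D)
    (hπ : TracksInfluencing f δ π (permW (E u) u ++ [(σ, δ k)]))
    (hequiv : FEquiv f u u') :
    (rightFac f u ((σ, dd k) :: permW (E (u ++ [(σ, dd k)]))⁻¹ v) =
        rightFac f u (permW (E u)⁻¹ ((σ, δ k) :: permW π v))) ∧
    (1 ≤ k →
      threeFac f u [(σ, dd k)] (permW (E (u ++ [(σ, dd k)]))⁻¹ v) =
        permFO (E u)⁻¹
          (foShift ((u.length : ℤ) - (u'.length : ℤ))
            (threeFac f (permW (E u') u') [(σ, δ k)] (permW π v)))) ∧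
    (k = 0 →
      threeFac f u [(σ, dd k)] (permW (E (u ++ [(σ, dd k)]))⁻¹ v) =
        permFO ((E u)⁻¹ * Equiv.swap (δ 0) (E u (dd 0)))
          (foShift ((u.length : ℤ) - (u'.length : ℤ))
            (threeFac f (permW (E u') u') [(σ, δ k)] (permW π v)))) := by
  classical
  set φ := E u with hφdef
  set L := (List.range m).map fun k => dd (k + 1) with hL
  have hLlen : L.length = m := by simp [hL]
  have hLget : ∀ i (hi : i < L.length), L[i] = dd (i + 1) := by intro i hi; simp [hL]
  have hφ : ∀ i, i < m → φ (dd (i + 1)) = δ (i + 1) := by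
    intro i hi
    have := equalize hperm hE u L hifl i (by omega)
    rwa [hLget] at this
  have hIfl : ∀ d, Influencing f d u → ∃ i, i < m ∧ d = dd (i + 1) := by
    intro d hd
    have := (hifl.1 d).2 hd
    rw [hL, List.mem_map] at this
    obtain ⟨i, hi, rfl⟩ := this
    exact ⟨i, List.mem_range.1 hi, rfl⟩
  set κ : Equiv.Perm D := φ⁻¹ * Equiv.swap (δ k) (φ (dd k)) with hκ
  have hκ1 : κ (δ k) = dd k := by simp [hκ]
  have hτdd : ∀ i, i < m → (κ * φ) (dd (i + 1)) = dd (i + 1) := by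
    intro i hi
    have hsw : Equiv.swap (δ k) (φ (dd k)) (δ (i + 1)) = δ (i + 1) := by
      rcases Nat.eq_zero_or_pos k with hk0 | hk0
      · subst hk0
        apply Equiv.swap_apply_of_ne_of_ne
        · exact (hδ0 (i + 1) (by omega) (by omega)).symm
        · rw [← hφ i hi]
          intro h
          exact hd0 (i + 1) (by omega) (by omega) (φ.injective h).symm
      · obtain ⟨j, rfl⟩ : ∃ j, k = j + 1 := ⟨k - 1, by omega⟩
        rw [hφ j (by omega)]
        simp
    rw [hκ, Equiv.Perm.mul_apply, Equiv.Perm.mul_apply, hφ i hi, hsw, ← hφ i hi]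
    simp
  have hτ0 : ∀ d, Influencing f d u → (κ * φ) d = d := by
    intro d hd
    obtain ⟨i, hi, rfl⟩ := hIfl d hd
    exact hτdd i hi
  have hsim : Sim f u (permW (κ * φ) u) := sim_perm hperm hpeek u _ hτ0
  set w := u ++ [(σ, dd k)] with hw
  set ψ := E w with hψ
  have hw2 : permW (κ * φ) u ++ [(σ, dd k)] = permW κ (permW φ u ++ [(σ, δ k)]) := by
    rw [permW_append, ← permW_mul, permW_cons]
    simp [hκ1, permW]
  have hLw := iflSeq_snoc hperm hpeek u σ (dd k) L hifl
  have hL2 : IsIflSeq f (permW (κ * φ) u) L := by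
    have := iflSeq_perm hperm (κ * φ) u L hifl
    have hmap : L.map (κ * φ) = L := by
      rw [hL, List.map_map]
      apply List.map_congr_left
      intro i hi
      exact hτdd i (List.mem_range.1 hi)
    rwa [hmap] at this
  have hLw2 := iflSeq_snoc hperm hpeek _ σ (dd k) L hL2
  have hsame : (fun e => decide (Influencing f e (permW (κ * φ) u ++ [(σ, dd k)]))) =
      (fun e => decide (Influencing f e (u ++ [(σ, dd k)]))) := by
    funext e
    exact decide_eq_decide.2 ((hsim.append [(σ, dd k)]).ifl hperm hpeek e).symm
  rw [hsame] at hLw2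
  generalize hLwdef : List.filter (fun e => decide (Influencing f e (u ++ [(σ, dd k)])))
    (dd k :: L.filter (fun e => decide (e ≠ dd k))) = Lw at hLw hLw2
  rw [hw2] at hLw2
  have hLw3 := iflSeq_perm hperm κ⁻¹ _ _ hLw2
  rw [← permW_mul, inv_mul_cancel, permW_one] at hLw3
  have hfix : ∀ d, Influencing f d w → (κ * π * ψ) d = d := by
    intro d hd
    obtain ⟨i, hi, rfl⟩ := List.getElem_of_mem ((hLw.1 d).2 hd)
    have e1 := equalize hperm hE w Lw hLw i hi
    have e2 := hπ _ hLw3 i (by simpa using hi)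
    simp only [List.get_eq_getElem, List.getElem_map] at e2
    rw [Equiv.Perm.mul_apply, Equiv.Perm.mul_apply, hψ, e1, ← e2]
    simp
  have hR : rightFac f w (permW ψ⁻¹ v) = rightFac f w (permW κ (permW π v)) := by
    rw [← lemmaB hperm hpeek w (permW ψ⁻¹ v) (κ * π * ψ) (fun d hd => hfix d (Or.inr hd)),
      ← permW_mul, ← permW_mul]
    congr 2
    group
  have hmain : threeFac f u [(σ, dd k)] (permW ψ⁻¹ v) =
      permFO κ (foShift ((u.length : ℤ) - (u'.length : ℤ))
        (threeFac f (permW (E u') u') [(σ, δ k)] (permW π v))) := by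
    have hleft : ∀ x, foShift ((u.length : ℤ) - (u'.length : ℤ))
        (leftFac f (permW (E u') u') x) = leftFac f (permW φ u) x := by
      intro x
      obtain ⟨ρ, hρ1, hρ2, -⟩ := hequiv
      obtain ⟨al, hal, halL⟩ := exists_aifl f u L hifl
      have hρL : IsIflSeq f (permW ρ u') L := by
        have := ((hρ2 al).2 hal).1
        rwa [halL] at this
      have hu'L := iflSeq_perm hperm ρ⁻¹ _ _ hρL
      rw [← permW_mul, inv_mul_cancel, permW_one] at hu'L
      have hφL := iflSeq_perm hperm φ _ _ hρL
      have hφ' : ∀ i, i < m → E u' (ρ⁻¹ (dd (i + 1))) = δ (i + 1) := by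
        intro i hi
        have := equalize hperm hE u' _ hu'L i (by simp [hLlen, hi])
        simpa [hLget] using this
      have hs : Sim f (permW φ (permW ρ u'))
          (permW (E u' * ρ⁻¹ * φ⁻¹) (permW φ (permW ρ u'))) := by
        apply sim_perm hperm hpeek
        intro d hd
        have := (hφL.1 d).2 hd
        rw [List.mem_map] at this
        obtain ⟨e, he, rfl⟩ := this
        rw [hL, List.mem_map] at he
        obtain ⟨i, hi, rfl⟩ := he
        have hi' := List.mem_range.1 hi
        rw [Equiv.Perm.mul_apply, Equiv.Perm.mul_apply, hφ i hi', ← hφ i hi']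
        have : φ⁻¹ (φ (dd (i + 1))) = dd (i + 1) := by simp
        rw [this, hφ' i hi', hφ i hi']
      have he : permW (E u' * ρ⁻¹ * φ⁻¹) (permW φ (permW ρ u')) = permW (E u') u' := by
        rw [← permW_mul, ← permW_mul]
        congr 1
        group
      rw [he] at hs
      rw [← hs.2.1]
      have hx : x = permW φ (permW φ⁻¹ x) := by
        rw [← permW_mul, mul_inv_cancel, permW_one]
      rw [hx, leftFac_perm hperm, leftFac_perm hperm, foShift_permFO, hρ1]
    have h3 := three_shift f (permW φ u) (permW (E u') u') [(σ, δ k)] (permW π v)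
      (by rw [permW_length, permW_length]; exact hleft _)
    rw [permW_length, permW_length] at h3
    rw [h3, ← threeFac_perm hperm, ← permW_mul, ← hsim.three]
    have hs : permW κ [(σ, δ k)] = [(σ, dd k)] := by simp [permW, hκ1]
    rw [hs, three_of_right, three_of_right, hR]
  refine ⟨?_, ?_, ?_⟩
  · have h1 : rightFac f u ([(σ, dd k)] ++ permW ψ⁻¹ v) =
        rightFac f u ([(σ, dd k)] ++ permW κ (permW π v)) := by
      rw [right_of_right, right_of_right, hR]
    have h2 : [(σ, dd k)] ++ permW κ (permW π v) =
        permW (κ * φ) (permW φ⁻¹ ((σ, δ k) :: permW π v)) := by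
      rw [← permW_mul (κ * φ), mul_inv_cancel_right, permW_cons, hκ1]
      rfl
    rw [h2, lemmaB hperm hpeek u _ _ (fun d hd => hτ0 d (Or.inr hd))] at h1
    exact h1
  · intro hk1
    have hκφ : κ = φ⁻¹ := by
      obtain ⟨j, rfl⟩ : ∃ j, k = j + 1 := ⟨k - 1, by omega⟩
      rw [hκ, hφ j (by omega), Equiv.swap_self]
      rfl
    rw [hmain, hκφ]
  · intro hk0
    rw [hmain, hκ]
    subst hk0
    rfl
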